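/- Suppose the star-connected occupied component C(0) containing the origin is finite and nonempty. Then the union ⋃_{S_k ∈ C(0)} D_k of the outermost boundary cycles of the squares of C(0) is a connected subgraph of G_C: any two vertices lying on outermost boundary cycles are joined by a path that uses only edges of outermost boundary cycles. -/

import Mathlib

/-!
Common framework: tile ℝ² into closed unit squares indexed by `ℤ²`, with corners
forming a translate of `ℤ²` and the origin the centre of the square `S₀` (index `(0,0)`).
A cycle is identified with its edge set (a set of unordered pairs of corners);
its interior (resp. exterior) is the union of the bounded (resp. unbounded)
connected components of the complement of the closed curve it traces in the plane.
-/

/-- Corners of the grid squares, indexed by `ℤ²`. -/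
abbrev GridV := ℤ × ℤ

/-- Embedding of corners into the plane: the square of index `z` is
`[z₁ - 1/2, z₁ + 1/2] × [z₂ - 1/2, z₂ + 1/2]`, so the origin is the centre of `S₀`. -/
noncomputable def toPlane (v : GridV) : ℝ × ℝ := ((v.1 : ℝ) - 1 / 2, (v.2 : ℝ) - 1 / 2)

/-- The closed unit square of index `z`. -/
def squareSet (z : GridV) : Set (ℝ × ℝ) :=
  Set.Icc ((z.1 : ℝ) - 1 / 2, (z.2 : ℝ) - 1 / 2) ((z.1 : ℝ) + 1 / 2, (z.2 : ℝ) + 1 / 2)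

/-- The four edges (unit segments) of the square of index `z`, as unordered pairs of corners. -/
def squareEdges (z : GridV) : Set (Sym2 GridV) :=
  {s(z, z + (1, 0)), s(z + (1, 0), z + (1, 1)), s(z + (1, 1), z + (0, 1)), s(z + (0, 1), z)}

/-- Adjacency of corners in the full grid graph `G`: Euclidean distance one. -/
def GridAdj (u v : GridV) : Prop := |u.1 - v.1| + |u.2 - v.2| = 1

/-- A cycle in the full grid graph: a cyclic sequence `(v₀, …, v_{n-1}, v₀)` of
distinct corners with consecutive corners adjacent. -/
structure GridCycle where
  n : ℕ
  hn : 3 ≤ n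
  f : ZMod n → GridV
  inj : Function.Injective f
  adj : ∀ i, GridAdj (f i) (f (i + 1))

/-- The edge set of a grid cycle. -/
def GridCycle.edgeSet (C : GridCycle) : Set (Sym2 GridV) :=
  {e | ∃ i : ZMod C.n, e = s(C.f i, C.f (i + 1))}

/-- An edge set is (the edge set of) a cycle of the grid graph `G`.
We identify a cycle with its edge set. -/
def IsCycle (E : Set (Sym2 GridV)) : Prop := ∃ C : GridCycle, C.edgeSet = E

/-- A cycle of the subgraph of the grid graph with edge set `G`. -/
def IsCycleIn (G E : Set (Sym2 GridV)) : Prop := IsCycle E ∧ E ⊆ G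

/-- The vertices incident to some edge of `E`. -/
def vertexSetOf (E : Set (Sym2 GridV)) : Set GridV := {v | ∃ e ∈ E, v ∈ e}

/-- The closed segment in the plane realizing an edge. -/
noncomputable def edgeSeg : Sym2 GridV → Set (ℝ × ℝ) :=
  Sym2.lift ⟨fun a b => segment ℝ (toPlane a) (toPlane b), fun _ _ => segment_symm ℝ _ _⟩

/-- The closed curve in the plane traced by the edges of `E`. -/
noncomputable def carrierOf (E : Set (Sym2 GridV)) : Set (ℝ × ℝ) := ⋃ e ∈ E, edgeSeg e

/-- The interior of a cycle: the union of the bounded connected components of the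
complement of its carrier curve. -/
noncomputable def interiorOf (E : Set (Sym2 GridV)) : Set (ℝ × ℝ) :=
  {p | p ∉ carrierOf E ∧ Bornology.IsBounded (connectedComponentIn (carrierOf E)ᶜ p)}

/-- The exterior of a cycle: the union of the unbounded connected components of the
complement of its carrier curve. -/
noncomputable def exteriorOf (E : Set (Sym2 GridV)) : Set (ℝ × ℝ) :=
  {p | p ∉ carrierOf E ∧ ¬ Bornology.IsBounded (connectedComponentIn (carrierOf E)ᶜ p)}

/-- The set `A` is contained in the interior of the cycle `E` (points of the
curve itself being allowed, so that e.g. a square whose boundary edges lie on the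
cycle counts as contained in the interior). -/
def inInterior (E : Set (Sym2 GridV)) (A : Set (ℝ × ℝ)) : Prop :=
  A ⊆ interiorOf E ∪ carrierOf E

/-- The set `A` lies in the exterior of the cycle `E` (points of the curve itself
being allowed). -/
def inExterior (E : Set (Sym2 GridV)) (A : Set (ℝ × ℝ)) : Prop :=
  A ⊆ exteriorOf E ∪ carrierOf E

/-- Star adjacency: distinct squares sharing at least a corner. -/
def starAdj (z w : GridV) : Prop := z ≠ w ∧ |z.1 - w.1| ≤ 1 ∧ |z.2 - w.2| ≤ 1

/-- Plus adjacency: squares sharing an edge. -/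
def plusAdj (z w : GridV) : Prop := |z.1 - w.1| + |z.2 - w.2| = 1

/-- The star-connected occupied component `C(0)` of the square `S₀` (of index `(0,0)`),
for the occupancy configuration `ω`; empty if `S₀` is vacant. -/
def starComp (ω : GridV → Prop) : Set GridV :=
  {z | ω z ∧ Relation.ReflTransGen (fun a b => ω a ∧ ω b ∧ starAdj a b) (0, 0) z}

/-- The plus-connected occupied component `C⁺(0)` of the square `S₀`. -/
def plusComp (ω : GridV → Prop) : Set GridV :=
  {z | ω z ∧ Relation.ReflTransGen (fun a b => ω a ∧ ω b ∧ plusAdj a b) (0, 0) z}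

/-- The edge set of the graph `G_C`: all edges of squares of `C(0)`. -/
def gcEdges (ω : GridV → Prop) : Set (Sym2 GridV) := ⋃ z ∈ starComp ω, squareEdges z

/-- The edge set of the graph `G⁺_C`: all edges of squares of `C⁺(0)`. -/
def gpcEdges (ω : GridV → Prop) : Set (Sym2 GridV) := ⋃ z ∈ plusComp ω, squareEdges z

/-- `e` is an outermost boundary edge of the graph with edge set `G`: for every
cycle `E` in this graph, either `e` is an edge of `E` or `e` lies in the exterior of `E`. -/
def outermostBoundaryEdgeIn (G : Set (Sym2 GridV)) (e : Sym2 GridV) : Prop :=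
  e ∈ G ∧ ∀ E, IsCycleIn G E → e ∈ E ∨ inExterior E (edgeSeg e)

/-- The subgraph spanned by the edge set `E` is connected: any two incident vertices
are joined by a walk using only edges of `E`. -/
def EdgeSetConnected (E : Set (Sym2 GridV)) : Prop :=
  ∀ u v, u ∈ vertexSetOf E → v ∈ vertexSetOf E →
    ∃ p : List GridV, p.head? = some u ∧ p.getLast? = some v ∧
      List.Chain' (fun a b => s(a, b) ∈ E) p

/-- `D` is the outermost boundary cycle `D_k` of the square of index `z` of the star
component `C(0)`: (a) the square lies in the interior of `D`; (b) every edge of `D` is a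
boundary edge adjacent to an occupied square of `C(0)` in the interior of `D` and to a
vacant square in the exterior of `D`; (c) every cycle of `G_C` containing the square in
its interior has all its edges on `D` or in the interior of `D`. -/
def isOutermostCycleOf (ω : GridV → Prop) (z : GridV) (D : Set (Sym2 GridV)) : Prop :=
  IsCycleIn (gcEdges ω) D ∧
  inInterior D (squareSet z) ∧
  (∀ e ∈ D,
    (∃ w ∈ starComp ω, e ∈ squareEdges w ∧ inInterior D (squareSet w)) ∧
    (∃ w, ¬ ω w ∧ e ∈ squareEdges w ∧ inExterior D (squareSet w))) ∧
  (∀ C, IsCycleIn (gcEdges ω) C → inInterior C (squareSet z) →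
    ∀ e ∈ C, e ∈ D ∨ inInterior D (edgeSeg e))

/-- The list of edges traversed by a walk given as a list of vertices. -/
def walkEdges (p : List GridV) : List (Sym2 GridV) :=
  List.zipWith (fun a b => s(a, b)) p p.tail

/-- The horizontal unit edge starting at the corner `v`. -/
def hEdge (v : GridV) : Sym2 GridV := s(v, v + (1, 0))

/-- The vertical unit edge starting at the corner `v`. -/
def vEdge (v : GridV) : Sym2 GridV := s(v, v + (0, 1))

lemma hEdge_mem_squareEdges {v w : GridV} :
    hEdge v ∈ squareEdges w ↔ w = v ∨ w = v - (0, 1) := by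
  obtain ⟨a, b⟩ := v
  obtain ⟨c, d⟩ := w
  simp only [hEdge, squareEdges, Set.mem_insert_iff, Set.mem_singleton_iff, Sym2.eq_iff,
    Prod.mk_add_mk, Prod.mk_sub_mk, Prod.mk.injEq]
  omega

lemma vEdge_mem_squareEdges {v w : GridV} :
    vEdge v ∈ squareEdges w ↔ w = v ∨ w = v - (1, 0) := by
  obtain ⟨a, b⟩ := v
  obtain ⟨c, d⟩ := w
  simp only [vEdge, squareEdges, Set.mem_insert_iff, Set.mem_singleton_iff, Sym2.eq_iff,
    Prod.mk_add_mk, Prod.mk_sub_mk, Prod.mk.injEq]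
  omega

lemma GridAdj.exists_edge {a b : GridV} (h : GridAdj a b) :
    ∃ v, s(a, b) = hEdge v ∨ s(a, b) = vEdge v := by
  obtain ⟨a, a'⟩ := a
  obtain ⟨b, b'⟩ := b
  simp only [GridAdj] at h
  have h1 := abs_cases (a - b)
  have h2 := abs_cases (a' - b')
  have : (b = a + 1 ∧ b' = a') ∨ (a = b + 1 ∧ a' = b') ∨ (b = a ∧ b' = a' + 1) ∨
      (b = a ∧ a' = b' + 1) := by omega
  rcases this with ⟨rfl, rfl⟩ | ⟨rfl, rfl⟩ | ⟨rfl, rfl⟩ | ⟨rfl, rfl⟩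
  · exact ⟨(a, b'), by simp [hEdge]⟩
  · exact ⟨(b, a'), by simp [hEdge]⟩
  · exact ⟨(b, a'), by simp [vEdge]⟩
  · exact ⟨(b, b'), by simp [vEdge]⟩

lemma exists_edge_of_mem_squareEdges {e : Sym2 GridV} {w : GridV} (h : e ∈ squareEdges w) :
    ∃ v, e = hEdge v ∨ e = vEdge v := by
  rcases h with rfl | rfl | rfl | rfl <;> exact GridAdj.exists_edge (by simp [GridAdj])

lemma squareEdges_eq_or_eq {e : Sym2 GridV} {a b c : GridV} (ha : e ∈ squareEdges a)
    (hb : e ∈ squareEdges b) (hc : e ∈ squareEdges c) (hab : a ≠ b) : c = a ∨ c = b := by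
  obtain ⟨v, rfl | rfl⟩ := exists_edge_of_mem_squareEdges ha
  · simp only [hEdge_mem_squareEdges] at ha hb hc
    grind
  · simp only [vEdge_mem_squareEdges] at ha hb hc
    grind

/-- The edges separating a square of `F` from a square outside `F`. -/
def faceBoundary (F : Set GridV) : Set (Sym2 GridV) :=
  {e | ∃ a b, a ∈ F ∧ b ∉ F ∧ e ∈ squareEdges a ∧ e ∈ squareEdges b}

lemma hEdge_mem_faceBoundary {F : Set GridV} {v : GridV} :
    hEdge v ∈ faceBoundary F ↔ ¬ (v ∈ F ↔ v - (0, 1) ∈ F) := by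
  simp only [faceBoundary, hEdge_mem_squareEdges, Set.mem_ofPred_eq]
  constructor
  · rintro ⟨a, b, ha, hb, rfl | rfl, rfl | rfl⟩ <;> tauto
  · intro h
    by_cases hv : v ∈ F
    · exact ⟨v, v - (0, 1), by tauto⟩
    · exact ⟨v - (0, 1), v, by tauto⟩

lemma vEdge_mem_faceBoundary {F : Set GridV} {v : GridV} :
    vEdge v ∈ faceBoundary F ↔ ¬ (v ∈ F ↔ v - (1, 0) ∈ F) := by
  simp only [faceBoundary, vEdge_mem_squareEdges, Set.mem_ofPred_eq]
  constructor
  · rintro ⟨a, b, ha, hb, rfl | rfl, rfl | rfl⟩ <;> tauto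
  · intro h
    by_cases hv : v ∈ F
    · exact ⟨v, v - (1, 0), by tauto⟩
    · exact ⟨v - (1, 0), v, by tauto⟩

lemma exists_edge_of_mem_faceBoundary {F : Set GridV} {e : Sym2 GridV}
    (h : e ∈ faceBoundary F) : ∃ v, e = hEdge v ∨ e = vEdge v := by
  obtain ⟨a, b, -, -, h, -⟩ := h
  exact exists_edge_of_mem_squareEdges h

lemma mem_or_mem_of_mem_faceBoundary {F : Set GridV} {e : Sym2 GridV} {a b : GridV}
    (h : e ∈ faceBoundary F) (ha : e ∈ squareEdges a) (hb : e ∈ squareEdges b) (hab : a ≠ b) :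
    (a ∈ F ∧ b ∉ F) ∨ (b ∈ F ∧ a ∉ F) := by
  obtain ⟨c, d, hc, hd, hec, hed⟩ := h
  have h1 := squareEdges_eq_or_eq ha hb hec hab
  have h2 := squareEdges_eq_or_eq ha hb hed hab
  rcases h1 with rfl | rfl <;> rcases h2 with rfl | rfl <;> tauto

/-- A ray leaving a square of a finite set eventually exits the set. -/
lemma exists_exit {F : Set GridV} (hF : F.Finite) {w d : GridV} (hw : w ∈ F) (hd : d ≠ 0) :
    ∃ k : ℕ, w + k • d ∈ F ∧ w + k • d + d ∉ F := by
  by_contra! h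
  have hall : ∀ k : ℕ, w + k • d ∈ F := by
    intro k
    induction k with
    | zero => simpa using hw
    | succ k ih => rw [succ_nsmul, ← add_assoc]; exact h k ih
  refine Set.infinite_univ (α := ℕ) ?_
  refine Set.Finite.of_injOn (f := fun k : ℕ => w + k • d) (fun k _ => hall k) ?_ hF
  intro i _ j _ hij
  have : (i : ℤ) • d = (j : ℤ) • d := by simpa using hij
  exact_mod_cast smul_left_injective ℤ hd this

lemma faceBoundary_nonempty {F : Set GridV} (hF : F.Finite) (hne : F.Nonempty) :
    (faceBoundary F).Nonempty := by
  obtain ⟨w, hw⟩ := hne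
  obtain ⟨k, h1, h2⟩ := exists_exit hF hw (d := (0, 1)) (by simp)
  refine ⟨hEdge (w + k • (0, 1) + (0, 1)), hEdge_mem_faceBoundary.2 ?_⟩
  rw [add_sub_cancel_right]
  tauto

lemma faceBoundary_injOn {A B : Set GridV} (hA : A.Finite) (hB : B.Finite)
    (h : faceBoundary A = faceBoundary B) : A = B := by
  by_contra hne
  have hfin : (symmDiff A B).Finite := (hA.union hB).subset Set.symmDiff_subset_union
  have hne' : (symmDiff A B).Nonempty := by
    rw [Set.nonempty_iff_ne_empty]
    simpa [symmDiff_eq_bot] using fun h0 => hne (symmDiff_eq_bot.1 h0)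
  obtain ⟨w, hw⟩ := hne'
  obtain ⟨k, h1, h2⟩ := exists_exit hfin hw (d := (0, 1)) (by simp)
  generalize w + k • ((0, 1) : GridV) = v at h1 h2
  have := hEdge_mem_faceBoundary (F := A) (v := v + (0, 1))
  rw [h, hEdge_mem_faceBoundary] at this
  simp only [Set.mem_symmDiff, add_sub_cancel_right] at h1 h2 this
  tauto

/-- Every edge of `E` can be continued, at each of its ends, by a different edge of `E`. -/
def NoDeadEnd (E : Set (Sym2 GridV)) : Prop :=
  ∀ a b, s(a, b) ∈ E → ∃ c, c ≠ a ∧ s(b, c) ∈ E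

lemma gridAdj_of_mem_squareEdges {a b w : GridV} (h : s(a, b) ∈ squareEdges w) :
    GridAdj a b := by
  obtain ⟨a, a'⟩ := a
  obtain ⟨b, b'⟩ := b
  obtain ⟨c, d⟩ := w
  simp only [squareEdges, Set.mem_insert_iff, Set.mem_singleton_iff, Sym2.eq_iff,
    Prod.mk_add_mk, Prod.mk.injEq] at h
  have h1 := abs_cases (a - b)
  have h2 := abs_cases (a' - b')
  simp only [GridAdj]
  omega

lemma GridAdj.eq_or {a b : GridV} (h : GridAdj a b) :
    a = b + (1, 0) ∨ a = b - (1, 0) ∨ a = b + (0, 1) ∨ a = b - (0, 1) := by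
  obtain ⟨a, a'⟩ := a
  obtain ⟨b, b'⟩ := b
  have h1 := abs_cases (a - b)
  have h2 := abs_cases (a' - b')
  simp only [GridAdj, Prod.mk_add_mk, Prod.mk_sub_mk, Prod.mk.injEq] at h ⊢
  omega

lemma mk_add_eq_hEdge (b : GridV) : s(b, b + (1, 0)) = hEdge b := rfl

lemma mk_add_eq_vEdge (b : GridV) : s(b, b + (0, 1)) = vEdge b := rfl

lemma mk_sub_eq_hEdge (b : GridV) : s(b, b - (1, 0)) = hEdge (b - (1, 0)) := by
  simp [hEdge, Sym2.eq_swap]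

lemma mk_sub_eq_vEdge (b : GridV) : s(b, b - (0, 1)) = vEdge (b - (0, 1)) := by
  simp [vEdge, Sym2.eq_swap]

lemma noDeadEnd_faceBoundary (F : Set GridV) : NoDeadEnd (faceBoundary F) := by
  intro a b hab
  have hadj : GridAdj a b := by
    obtain ⟨c, d, -, -, h, -⟩ := hab
    exact gridAdj_of_mem_squareEdges h
  rw [Sym2.eq_swap] at hab
  have h1 : s(b, b + (1, 0)) ∈ faceBoundary F ↔ ¬ (b ∈ F ↔ b - (0, 1) ∈ F) :=
    hEdge_mem_faceBoundary
  have h2 : s(b, b + (0, 1)) ∈ faceBoundary F ↔ ¬ (b ∈ F ↔ b - (1, 0) ∈ F) :=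
    vEdge_mem_faceBoundary
  have h3 : s(b, b - (1, 0)) ∈ faceBoundary F ↔ ¬ (b - (1, 0) ∈ F ↔ b - (1, 0) - (0, 1) ∈ F) := by
    rw [mk_sub_eq_hEdge]; exact hEdge_mem_faceBoundary
  have h4 : s(b, b - (0, 1)) ∈ faceBoundary F ↔ ¬ (b - (0, 1) ∈ F ↔ b - (1, 0) - (0, 1) ∈ F) := by
    rw [mk_sub_eq_vEdge, sub_right_comm]; exact vEdge_mem_faceBoundary
  by_contra! hc
  have e1 := hc (b + (1, 0))
  have e2 := hc (b + (0, 1))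
  have e3 := hc (b - (1, 0))
  have e4 := hc (b - (0, 1))
  rw [h1] at e1
  rw [h2] at e2
  rw [h3] at e3
  rw [h4] at e4
  have n : ∀ x y : ℤ × ℤ, x ≠ y → b + x ≠ b + y := by simp
  have n12 := n (1, 0) (0, 1) (by simp)
  have n13 := n (1, 0) (-(1, 0)) (by simp)
  have n14 := n (1, 0) (-(0, 1)) (by simp)
  have n23 := n (0, 1) (-(1, 0)) (by simp)
  have n24 := n (0, 1) (-(0, 1)) (by simp)
  have n34 := n (-(1, 0)) (-(0, 1)) (by simp)
  simp only [← sub_eq_add_neg] at n13 n14 n23 n24 n34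
  rcases hadj.eq_or with rfl | rfl | rfl | rfl
  · rw [h1] at hab
    replace e2 := e2 n12.symm; replace e3 := e3 n13.symm; replace e4 := e4 n14.symm
    clear * - hab e2 e3 e4; grind
  · rw [h3] at hab
    replace e1 := e1 n13; replace e2 := e2 n23; replace e4 := e4 n34.symm
    clear * - hab e1 e2 e4; grind
  · rw [h2] at hab
    replace e1 := e1 n12; replace e3 := e3 n23.symm; replace e4 := e4 n24.symm
    clear * - hab e1 e3 e4; grind
  · rw [h4] at hab
    replace e1 := e1 n14; replace e2 := e2 n24; replace e3 := e3 n34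
    clear * - hab e1 e2 e3; grind

lemma GridCycle.edge_mem_iff (C : GridCycle) (i : ZMod C.n) (c : GridV) :
    s(C.f i, c) ∈ C.edgeSet ↔ c = C.f (i + 1) ∨ c = C.f (i - 1) := by
  constructor
  · rintro ⟨j, hj⟩
    rcases Sym2.eq_iff.1 hj with ⟨h1, h2⟩ | ⟨h1, h2⟩
    · rw [C.inj h1]; exact Or.inl h2
    · have := C.inj h1
      right
      rw [h2, this, add_sub_cancel_right]
  · rintro (rfl | rfl)
    · exact ⟨i, rfl⟩
    · exact ⟨i - 1, by rw [sub_add_cancel, Sym2.eq_swap]⟩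

lemma GridCycle.f_add_one_ne (C : GridCycle) (i : ZMod C.n) : C.f (i + 1) ≠ C.f (i - 1) := by
  intro h
  have h2 := C.inj h
  have h3 : ((2 : ℕ) : ZMod C.n) = 0 := by
    push_cast
    linear_combination h2
  rw [ZMod.natCast_eq_zero_iff] at h3
  have := Nat.le_of_dvd (by norm_num) h3
  have := C.hn
  omega

lemma GridCycle.induction (C : GridCycle) {P : ZMod C.n → Prop} {i : ZMod C.n} (hi : P i)
    (hs : ∀ j, P j → P (j + 1)) (j : ZMod C.n) : P j := by
  have : NeZero C.n := ⟨by have := C.hn; omega⟩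
  have key : ∀ k : ℕ, P (i + k) := by
    intro k
    induction k with
    | zero => simpa using hi
    | succ k ih => push_cast; rw [← add_assoc]; exact hs _ ih
  have := key (j - i).val
  rwa [ZMod.natCast_zmod_val, add_sub_cancel] at this

lemma IsCycle.eq_of_subset {E Z : Set (Sym2 GridV)} (hE : IsCycle E) (hZE : Z ⊆ E)
    (hne : Z.Nonempty) (hZ : NoDeadEnd Z) : Z = E := by
  obtain ⟨C, rfl⟩ := hE
  refine hZE.antisymm ?_
  obtain ⟨e, he⟩ := hne
  obtain ⟨i, rfl⟩ := hZE he
  rintro _ ⟨j, rfl⟩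
  refine C.induction (P := fun j => s(C.f j, C.f (j + 1)) ∈ Z) he (fun j hj => ?_) j
  obtain ⟨c, hc, hcZ⟩ := hZ _ _ hj
  rcases (C.edge_mem_iff _ _).1 (hZE hcZ) with h | h
  · rwa [h] at hcZ
  · rw [add_sub_cancel_right] at h
    exact absurd h hc

lemma IsCycle.finite {E : Set (Sym2 GridV)} (hE : IsCycle E) : E.Finite := by
  obtain ⟨C, rfl⟩ := hE
  have : NeZero C.n := ⟨by have := C.hn; omega⟩
  refine (Set.finite_range fun i : ZMod C.n => s(C.f i, C.f (i + 1))).subset ?_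
  rintro _ ⟨i, rfl⟩
  exact ⟨i, rfl⟩

lemma IsCycle.nonempty {E : Set (Sym2 GridV)} (hE : IsCycle E) : E.Nonempty := by
  obtain ⟨C, rfl⟩ := hE
  exact ⟨_, 0, rfl⟩

lemma IsCycle.gridAdj {E : Set (Sym2 GridV)} (hE : IsCycle E) {a b : GridV}
    (h : s(a, b) ∈ E) : GridAdj a b := by
  obtain ⟨C, rfl⟩ := hE
  obtain ⟨i, hi⟩ := h
  have hadj := C.adj i
  rcases Sym2.eq_iff.1 hi with ⟨rfl, rfl⟩ | ⟨rfl, rfl⟩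
  · exact hadj
  · simpa only [GridAdj, abs_sub_comm] using hadj

lemma IsCycle.exists_edge {E : Set (Sym2 GridV)} (hE : IsCycle E) {e : Sym2 GridV}
    (h : e ∈ E) : ∃ v, e = hEdge v ∨ e = vEdge v := by
  induction e with | _ a b => exact (hE.gridAdj h).exists_edge

/-- A finite nonempty edge set without dead ends contains a cycle. -/
lemma exists_isCycle_subset {E : Set (Sym2 GridV)} (hfin : E.Finite) (hne : E.Nonempty)
    (hE : NoDeadEnd E) (hadj : ∀ a b, s(a, b) ∈ E → GridAdj a b) :
    ∃ Z, IsCycle Z ∧ Z ⊆ E := by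
  have hirr : ∀ a b, s(a, b) ∈ E → a ≠ b := by
    rintro a b h rfl
    simpa [GridAdj] using hadj _ _ h
  choose g hg1 hg2 using hE
  let T := {p : GridV × GridV // s(p.1, p.2) ∈ E}
  let nxt : T → T := fun p => ⟨(p.1.2, g _ _ p.2), hg2 _ _ p.2⟩
  obtain ⟨e, he⟩ := hne
  obtain ⟨a, b⟩ := e
  let y : ℕ → T := fun k => nxt^[k] ⟨(a, b), he⟩
  have hy : ∀ k, y (k + 1) = nxt (y k) := fun k => Function.iterate_succ_apply' _ _ _
  let x : ℕ → GridV := fun k => (y k).1.1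
  have hx1 : ∀ k, x (k + 1) = (y k).1.2 := fun k => by simp only [x, hy]; rfl
  have hxE : ∀ k, s(x k, x (k + 1)) ∈ E := fun k => by rw [hx1]; exact (y k).2
  have hx2 : ∀ k, x (k + 2) ≠ x k := fun k => by
    rw [hx1 (k + 1), hy]
    exact hg1 _ _ (y k).2
  have hvert : (Set.univ : Set ℕ).MapsTo x (vertexSetOf E) :=
    fun k _ => ⟨_, hxE k, Sym2.mem_mk_left _ _⟩
  have hvfin : (vertexSetOf E).Finite := by
    have : vertexSetOf E = ⋃ e ∈ E, {v | v ∈ e} := by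
      ext v; simp [vertexSetOf]
    rw [this]
    refine hfin.biUnion fun e _ => ?_
    induction e with | _ a b =>
    refine (Set.toFinite {a, b}).subset fun v hv => ?_
    simpa using hv
  have hrep : ∃ m, ∃ i, 0 < m ∧ x (i + m) = x i := by
    obtain ⟨i, -, j, -, hij, h⟩ :=
      Set.infinite_univ.exists_ne_map_eq_of_mapsTo hvert hvfin
    rcases lt_or_gt_of_ne hij with hl | hl
    · exact ⟨j - i, i, by omega, by rw [show i + (j - i) = j by omega, h]⟩
    · exact ⟨i - j, j, by omega, by rw [show j + (i - j) = i by omega, h]⟩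
  classical
  let m := Nat.find hrep
  obtain ⟨i, hm0, hm⟩ := Nat.find_spec hrep
  change 0 < m at hm0
  change x (i + m) = x i at hm
  have hmin : ∀ j l, 0 < l → l < m → x (j + l) ≠ x j := fun j l h0 hl h =>
    Nat.find_min hrep hl ⟨j, h0, h⟩
  have hm3 : 3 ≤ m := by
    by_contra hlt
    have : m = 1 ∨ m = 2 := by omega
    rcases this with h | h
    · rw [h] at hm
      exact hirr _ _ (hxE i) hm.symm
    · rw [h] at hm
      exact hx2 i hm
  have : NeZero m := ⟨by omega⟩
  have : Fact (1 < m) := ⟨by omega⟩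
  have hstep : ∀ k : ZMod m, x (i + (k + 1).val) = x (i + k.val + 1) := by
    intro k
    rw [ZMod.val_add, ZMod.val_one]
    have := ZMod.val_lt k
    rcases Nat.lt_or_ge (k.val + 1) m with h | h
    · rw [Nat.mod_eq_of_lt h, add_assoc]
    · have h' : k.val + 1 = m := by omega
      rw [add_assoc, h', Nat.mod_self, hm, add_zero]
  have hinj : Function.Injective fun k : ZMod m => x (i + k.val) := by
    intro k l hkl
    have hk := ZMod.val_lt k
    have hl := ZMod.val_lt l
    by_contra hne
    have hne' : k.val ≠ l.val := fun h => hne (ZMod.val_injective m h)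
    rcases lt_or_gt_of_ne hne' with h | h
    · refine hmin (i + k.val) (l.val - k.val) (by omega) (by omega) ?_
      rw [show i + k.val + (l.val - k.val) = i + l.val by omega]
      exact hkl.symm
    · refine hmin (i + l.val) (k.val - l.val) (by omega) (by omega) ?_
      rw [show i + l.val + (k.val - l.val) = i + k.val by omega]
      exact hkl
  let C : GridCycle :=
    { n := m
      hn := hm3
      f := fun k => x (i + k.val)
      inj := hinj
      adj := fun k => by rw [hstep]; exact hadj _ _ (hxE _) }
  refine ⟨C.edgeSet, ⟨C, rfl⟩, ?_⟩
  rintro _ ⟨k, rfl⟩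
  change s(x (i + k.val), x (i + (k + 1).val)) ∈ E
  rw [hstep]
  exact hxE _

open Classical in
/-- The indicator of a set of edges with values in the field with two elements. -/
noncomputable def edgeInd (E : Set (Sym2 GridV)) (e : Sym2 GridV) : ZMod 2 :=
  if e ∈ E then 1 else 0

lemma edgeInd_eq_one_iff {E : Set (Sym2 GridV)} {e : Sym2 GridV} : edgeInd E e = 1 ↔ e ∈ E := by
  simp [edgeInd]

lemma edgeInd_eq_zero {E : Set (Sym2 GridV)} {e : Sym2 GridV} (h : e ∉ E) : edgeInd E e = 0 := by
  simp [edgeInd, h]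

open Classical in
lemma sum_indicator_of_gridAdj {a b : GridV} (h : GridAdj a b) :
    (if b + (1, 0) = a then 1 else 0 : ZMod 2) + (if b - (1, 0) = a then 1 else 0) +
      (if b + (0, 1) = a then 1 else 0) + (if b - (0, 1) = a then 1 else 0) = 1 := by
  have n : ∀ x y : ℤ × ℤ, b + x = b + y ↔ x = y := by simp
  rcases h.eq_or with rfl | rfl | rfl | rfl <;> simp only [sub_eq_add_neg, n] <;> simp

/-- Each vertex has even degree in a cycle. -/
lemma IsCycle.even_degree {E : Set (Sym2 GridV)} (hE : IsCycle E) (v : GridV) :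
    edgeInd E (hEdge v) + edgeInd E (hEdge (v - (1, 0))) + edgeInd E (vEdge v) +
      edgeInd E (vEdge (v - (0, 1))) = 0 := by
  classical
  rw [← mk_sub_eq_hEdge, ← mk_sub_eq_vEdge, ← mk_add_eq_hEdge, ← mk_add_eq_vEdge]
  obtain ⟨C, rfl⟩ := hE
  by_cases hv : ∃ i, C.f i = v
  · obtain ⟨i, rfl⟩ := hv
    have hne := C.f_add_one_ne i
    have key : ∀ c, edgeInd C.edgeSet s(C.f i, c) =
        (if c = C.f (i + 1) then 1 else 0 : ZMod 2) + (if c = C.f (i - 1) then 1 else 0) := by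
      intro c
      simp only [edgeInd, C.edge_mem_iff]
      by_cases h1 : c = C.f (i + 1)
      · simp [h1, hne]
      · simp [h1]
    have h1 := sum_indicator_of_gridAdj (a := C.f (i + 1)) (b := C.f i) (by
      simpa only [GridAdj, abs_sub_comm] using C.adj i)
    have h2 := sum_indicator_of_gridAdj (a := C.f (i - 1)) (b := C.f i) (by
      simpa only [sub_add_cancel] using C.adj (i - 1))
    simp only [key]
    have h3 : (2 : ZMod 2) = 0 := by decide
    linear_combination h1 + h2 + h3
  · have key : ∀ c, edgeInd C.edgeSet s(v, c) = 0 := by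
      intro c
      refine edgeInd_eq_zero ?_
      rintro ⟨j, hj⟩
      rcases Sym2.eq_iff.1 hj with ⟨h1, h2⟩ | ⟨h1, h2⟩
      · exact hv ⟨_, h1.symm⟩
      · exact hv ⟨_, h1.symm⟩
    simp [key]

lemma exists_bound_of_finite {S : Set GridV} (hS : S.Finite) :
    ∃ N : ℤ, ∀ v ∈ S, |v.1| < N ∧ |v.2| < N := by
  obtain ⟨M, hM⟩ := (hS.image fun v => max |v.1| |v.2|).bddAbove
  refine ⟨M + 1, fun v hv => ?_⟩
  have h : max |v.1| |v.2| ≤ M := hM ⟨v, hv, rfl⟩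
  exact ⟨by linarith [le_max_left |v.1| |v.2|], by linarith [le_max_right |v.1| |v.2|]⟩

lemma finite_of_bound {S : Set GridV} (N : ℤ) (h : ∀ v ∈ S, |v.1| ≤ N ∧ |v.2| ≤ N) :
    S.Finite := by
  refine (Set.finite_Icc ((-N, -N) : GridV) (N, N)).subset fun v hv => ?_
  have := h v hv
  exact ⟨⟨(abs_le.1 this.1).1, (abs_le.1 this.2).1⟩, ⟨(abs_le.1 this.1).2, (abs_le.1 this.2).2⟩⟩

/-- Every cycle is the boundary of a finite set of squares. -/
lemma IsCycle.exists_faceBoundary {E : Set (Sym2 GridV)} (hE : IsCycle E) :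
    ∃ F : Set GridV, F.Finite ∧ faceBoundary F = E := by
  set h : ℤ → ℤ → ZMod 2 := fun x y => edgeInd E (hEdge (x, y)) with hh
  set u : ℤ → ℤ → ZMod 2 := fun x y => edgeInd E (vEdge (x, y)) with hu
  have heven : ∀ x y, h x y + h (x - 1) y + u x y + u x (y - 1) = 0 := fun x y => by
    simpa [hh, hu] using hE.even_degree (x, y)
  obtain ⟨N, hN⟩ := exists_bound_of_finite (S := {v | hEdge v ∈ E} ∪ {v | vEdge v ∈ E}) (by
    refine Set.Finite.union ?_ ?_
    · refine hE.finite.preimage (f := hEdge) ?_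
      rintro ⟨a, b⟩ - ⟨c, d⟩ - hab
      simp only [hEdge, Sym2.eq_iff, Prod.mk_add_mk, Prod.mk.injEq] at hab ⊢
      omega
    · refine hE.finite.preimage (f := vEdge) ?_
      rintro ⟨a, b⟩ - ⟨c, d⟩ - hab
      simp only [vEdge, Sym2.eq_iff, Prod.mk_add_mk, Prod.mk.injEq] at hab ⊢
      omega)
  have hout : ∀ x y, (N ≤ |x| ∨ N ≤ |y|) → h x y = 0 ∧ u x y = 0 := by
    intro x y hxy
    constructor
    · refine edgeInd_eq_zero fun hmem => ?_
      have := hN (x, y) (Or.inl hmem)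
      dsimp only at this
      omega
    · refine edgeInd_eq_zero fun hmem => ?_
      have := hN (x, y) (Or.inr hmem)
      dsimp only at this
      omega
  have habs : ∀ x : ℤ, (x ≤ -N ∨ N ≤ x) → N ≤ |x| := fun x hx => by
    rcases hx with hx | hx
    · linarith [neg_abs_le x]
    · linarith [le_abs_self x]
  set f : ℤ → ℤ → ZMod 2 := fun x y => ∑ j ∈ Finset.Ioc (-N) y, h x j with hf
  have hflow : ∀ x y, y ≤ -N → f x y = 0 := fun x y hy => by
    simp [hf, Finset.Ioc_eq_empty_of_le hy]
  have hvert : ∀ x y, f x y = f x (y - 1) + h x y := by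
    intro x y
    rcases le_or_gt y (-N) with hy | hy
    · rw [hflow x y hy, hflow x (y - 1) (by omega), (hout x y (Or.inr (habs y (Or.inl hy)))).1,
        add_zero]
    · have : Finset.Ioc (-N) y = insert y (Finset.Ioc (-N) (y - 1)) := by
        ext j
        simp only [Finset.mem_Ioc, Finset.mem_insert]
        omega
      simp only [hf]
      rw [this, Finset.sum_insert (by simp), add_comm]
  have h2 : (2 : ZMod 2) = 0 := by decide
  have hhor : ∀ x y, f x y = f (x - 1) y + u x y := by
    intro x y
    rcases le_or_gt y (-N) with hy | hy
    · rw [hflow x y hy, hflow (x - 1) y hy, (hout x y (Or.inr (habs y (Or.inl hy)))).2, add_zero]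
    · refine Int.leInduction (m := -N) (motive := fun y _ => f x y = f (x - 1) y + u x y)
        ?_ ?_ y hy.le
      · rw [hflow x _ le_rfl, hflow (x - 1) _ le_rfl,
          (hout x _ (Or.inr (habs _ (Or.inl le_rfl)))).2, add_zero]
      · intro y _ ih
        have h3 := heven x (y + 1)
        rw [add_sub_cancel_right] at h3
        rw [hvert x, hvert (x - 1), add_sub_cancel_right, ih]
        linear_combination h3 - (h (x - 1) (y + 1) + u x (y + 1)) * h2
  refine ⟨{v | f v.1 v.2 = 1}, ?_, ?_⟩
  · refine finite_of_bound N fun v hv => ?_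
    obtain ⟨x, y⟩ := v
    change f x y = 1 at hv
    have hcol : ∀ x y, N ≤ |x| → f x y = 0 := fun x y hx =>
      Finset.sum_eq_zero fun j _ => (hout x j (Or.inl hx)).1
    constructor
    · by_contra hx
      rw [hcol x y (by simpa using (not_le.1 hx).le)] at hv
      exact zero_ne_one hv
    · by_contra hy
      dsimp only at hy
      have hzero : f x y = 0 := by
        rcases le_or_gt x (-N) with hx | hx
        · exact hcol x y (habs _ (Or.inl hx))
        · refine Int.leInduction (m := -N) (motive := fun x _ => f x y = 0) ?_ ?_ x hx.le
          · exact hcol _ y (habs _ (Or.inl le_rfl))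
          · intro x _ ih
            rw [hhor, add_sub_cancel_right, ih, (hout _ _ (Or.inr (not_le.1 hy).le)).2, add_zero]
      rw [hzero] at hv
      exact zero_ne_one hv
  · have hdec : ∀ a b c : ZMod 2, a = b + c → (¬ (a = 1 ↔ b = 1) ↔ c = 1) := by decide
    have hH : ∀ v, hEdge v ∈ faceBoundary {v | f v.1 v.2 = 1} ↔ hEdge v ∈ E := by
      intro v
      rw [hEdge_mem_faceBoundary, ← edgeInd_eq_one_iff]
      have := hvert v.1 v.2
      simpa using hdec _ _ _ this
    have hV : ∀ v, vEdge v ∈ faceBoundary {v | f v.1 v.2 = 1} ↔ vEdge v ∈ E := by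
      intro v
      rw [vEdge_mem_faceBoundary, ← edgeInd_eq_one_iff]
      have := hhor v.1 v.2
      simpa using hdec _ _ _ this
    ext e
    constructor
    · intro he
      obtain ⟨v, rfl | rfl⟩ := exists_edge_of_mem_faceBoundary he
      · exact (hH v).1 he
      · exact (hV v).1 he
    · intro he
      obtain ⟨v, rfl | rfl⟩ := hE.exists_edge he
      · exact (hH v).2 he
      · exact (hV v).2 he

lemma IsCycle.connected {E : Set (Sym2 GridV)} (hE : IsCycle E) {a b : GridV}
    (ha : a ∈ vertexSetOf E) (hb : b ∈ vertexSetOf E) :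
    Relation.ReflTransGen (fun a b => s(a, b) ∈ E) a b := by
  obtain ⟨C, rfl⟩ := hE
  have hvert : ∀ v ∈ vertexSetOf C.edgeSet, ∃ i, C.f i = v := by
    rintro v ⟨_, ⟨i, rfl⟩, hv⟩
    rcases Sym2.mem_iff.1 hv with rfl | rfl
    · exact ⟨i, rfl⟩
    · exact ⟨i + 1, rfl⟩
  obtain ⟨i, rfl⟩ := hvert a ha
  obtain ⟨j, rfl⟩ := hvert b hb
  exact C.induction (P := fun j => Relation.ReflTransGen (fun a b => s(a, b) ∈ C.edgeSet)
    (C.f i) (C.f j)) .refl (fun j hj => hj.tail ⟨j, rfl⟩) j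

lemma mem_squareSet {p : ℝ × ℝ} {w : GridV} :
    p ∈ squareSet w ↔ ((w.1 : ℝ) - 1 / 2 ≤ p.1 ∧ p.1 ≤ w.1 + 1 / 2) ∧
      ((w.2 : ℝ) - 1 / 2 ≤ p.2 ∧ p.2 ≤ w.2 + 1 / 2) := by
  simp only [squareSet, Set.mem_Icc, Prod.le_def]
  tauto

lemma mem_edgeSeg_hEdge {p : ℝ × ℝ} {v : GridV} :
    p ∈ edgeSeg (hEdge v) ↔
      ((v.1 : ℝ) - 1 / 2 ≤ p.1 ∧ p.1 ≤ v.1 + 1 / 2) ∧ p.2 = v.2 - 1 / 2 := by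
  have h : edgeSeg (hEdge v) = (fun x => (x, (v.2 : ℝ) - 1 / 2)) ''
      segment ℝ ((v.1 : ℝ) - 1 / 2) (v.1 + 1 / 2) := by
    rw [Prod.image_mk_segment_left]
    simp only [edgeSeg, hEdge, Sym2.lift_mk, toPlane]
    congr 2
    · rw [Prod.fst_add]; push_cast; ring
    · simp
  rw [h, segment_eq_Icc (by linarith)]
  constructor
  · rintro ⟨x, hx, rfl⟩
    exact ⟨hx, rfl⟩
  · rintro ⟨hx, hy⟩
    exact ⟨p.1, hx, by rw [← hy]⟩

lemma mem_edgeSeg_vEdge {p : ℝ × ℝ} {v : GridV} :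
    p ∈ edgeSeg (vEdge v) ↔
      p.1 = v.1 - 1 / 2 ∧ ((v.2 : ℝ) - 1 / 2 ≤ p.2 ∧ p.2 ≤ v.2 + 1 / 2) := by
  have h : edgeSeg (vEdge v) = (fun y => ((v.1 : ℝ) - 1 / 2, y)) ''
      segment ℝ ((v.2 : ℝ) - 1 / 2) (v.2 + 1 / 2) := by
    rw [Prod.image_mk_segment_right]
    simp only [edgeSeg, vEdge, Sym2.lift_mk, toPlane]
    congr 2
    · simp
    · rw [Prod.snd_add]; push_cast; ring
  rw [h, segment_eq_Icc (by linarith)]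
  constructor
  · rintro ⟨x, hx, rfl⟩
    exact ⟨rfl, hx⟩
  · rintro ⟨hx, hy⟩
    exact ⟨p.2, hy, by rw [← hx]⟩

lemma edgeSeg_subset_squareSet {e : Sym2 GridV} {w : GridV} (h : e ∈ squareEdges w) :
    edgeSeg e ⊆ squareSet w := by
  intro p hp
  rw [mem_squareSet]
  obtain ⟨v, rfl | rfl⟩ := exists_edge_of_mem_squareEdges h
  · rw [mem_edgeSeg_hEdge] at hp
    rcases hEdge_mem_squareEdges.1 h with rfl | rfl
    · exact ⟨hp.1, by linarith, by linarith⟩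
    · rw [Prod.fst_sub, Prod.snd_sub]
      push_cast
      exact ⟨by simpa using hp.1, by linarith, by linarith⟩
  · rw [mem_edgeSeg_vEdge] at hp
    rcases vEdge_mem_squareEdges.1 h with rfl | rfl
    · exact ⟨⟨by linarith, by linarith⟩, hp.2⟩
    · rw [Prod.fst_sub, Prod.snd_sub]
      push_cast
      exact ⟨⟨by linarith, by linarith⟩, by simpa using hp.2⟩

/-- A grid edge has a point which lies on no other grid edge. -/
lemma exists_mem_edgeSeg_unique {e : Sym2 GridV} (he : ∃ v, e = hEdge v ∨ e = vEdge v) :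
    ∃ m ∈ edgeSeg e, ∀ e', (∃ v, e' = hEdge v ∨ e' = vEdge v) → m ∈ edgeSeg e' → e' = e := by
  obtain ⟨⟨x, y⟩, rfl | rfl⟩ := he
  · refine ⟨((x : ℝ), (y : ℝ) - 1 / 2), mem_edgeSeg_hEdge.2 (by simp), ?_⟩
    rintro _ ⟨⟨a, b⟩, rfl | rfl⟩ h
    · rw [mem_edgeSeg_hEdge] at h
      dsimp only at h
      have h1 : (b : ℝ) = y := by linarith [h.2]
      have h2 : (a : ℝ) < x + 1 := by linarith [h.1.1]
      have h3 : (x : ℝ) < a + 1 := by linarith [h.1.2]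
      norm_cast at h1 h2 h3
      rw [h1, show a = x by omega]
    · rw [mem_edgeSeg_vEdge] at h
      dsimp only at h
      have h1 : (2 * x : ℝ) = 2 * a - 1 := by linarith [h.1]
      norm_cast at h1
      omega
  · refine ⟨((x : ℝ) - 1 / 2, (y : ℝ)), mem_edgeSeg_vEdge.2 (by simp), ?_⟩
    rintro _ ⟨⟨a, b⟩, rfl | rfl⟩ h
    · rw [mem_edgeSeg_hEdge] at h
      dsimp only at h
      have h1 : (2 * y : ℝ) = 2 * b - 1 := by linarith [h.2]
      norm_cast at h1
      omega
    · rw [mem_edgeSeg_vEdge] at h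
      dsimp only at h
      have h1 : (a : ℝ) = x := by linarith [h.1]
      have h2 : (b : ℝ) < y + 1 := by linarith [h.2.1]
      have h3 : (y : ℝ) < b + 1 := by linarith [h.2.2]
      norm_cast at h1 h2 h3
      rw [h1, show b = y by omega]

lemma mem_carrierOf {E : Set (Sym2 GridV)} {p : ℝ × ℝ} :
    p ∈ carrierOf E ↔ ∃ e ∈ E, p ∈ edgeSeg e := by
  simp [carrierOf]

/-- The centre of a grid square. -/
def squareCenter (w : GridV) : ℝ × ℝ := ((w.1 : ℝ), (w.2 : ℝ))

lemma squareCenter_mem (w : GridV) : squareCenter w ∈ squareSet w :=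
  mem_squareSet.2 (by simp [squareCenter])

lemma notMem_carrierOf_of_abs_lt {E : Set (Sym2 GridV)}
    (hE : ∀ e ∈ E, ∃ v, e = hEdge v ∨ e = vEdge v) {w : GridV} {p : ℝ × ℝ}
    (h1 : |p.1 - w.1| < 1 / 2) (h2 : |p.2 - w.2| < 1 / 2) : p ∉ carrierOf E := by
  rw [mem_carrierOf]
  rintro ⟨e, he, hp⟩
  rw [abs_lt] at h1 h2
  obtain ⟨v, rfl | rfl⟩ := hE e he
  · rw [mem_edgeSeg_hEdge] at hp
    have h3 : (w.2 : ℝ) < v.2 := by linarith [hp.2]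
    have h4 : (v.2 : ℝ) < w.2 + 1 := by linarith [hp.2]
    norm_cast at h3 h4
    omega
  · rw [mem_edgeSeg_vEdge] at hp
    have h3 : (w.1 : ℝ) < v.1 := by linarith [hp.1]
    have h4 : (v.1 : ℝ) < w.1 + 1 := by linarith [hp.1]
    norm_cast at h3 h4
    omega

lemma squareCenter_notMem_carrierOf {E : Set (Sym2 GridV)}
    (hE : ∀ e ∈ E, ∃ v, e = hEdge v ∨ e = vEdge v) (w : GridV) :
    squareCenter w ∉ carrierOf E :=
  notMem_carrierOf_of_abs_lt hE (w := w) (by simp [squareCenter]) (by simp [squareCenter])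

lemma squareCenter_mem_connectedComponentIn {E : Set (Sym2 GridV)}
    (hE : ∀ e ∈ E, ∃ v, e = hEdge v ∨ e = vEdge v) {w : GridV} {p : ℝ × ℝ}
    (hp : p ∈ squareSet w) (hpE : p ∉ carrierOf E) :
    squareCenter w ∈ connectedComponentIn (carrierOf E)ᶜ p := by
  refine (convex_segment (𝕜 := ℝ) p (squareCenter w)).isPreconnected.subset_connectedComponentIn
    (left_mem_segment ℝ _ _) ?_ (right_mem_segment ℝ _ _)
  rintro q ⟨a, b, ha, hb, hab, rfl⟩
  rcases hb.eq_or_lt with rfl | hb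
  · rw [add_zero] at hab
    simpa [hab] using hpE
  · obtain ⟨⟨h1, h2⟩, h3, h4⟩ := mem_squareSet.1 hp
    have hb' : b = 1 - a := by linarith
    refine notMem_carrierOf_of_abs_lt hE (w := w) ?_ ?_
    · have : (a • p + b • squareCenter w).1 - w.1 = a * (p.1 - w.1) := by
        simp [squareCenter, hb']; ring
      rw [this, abs_lt]
      constructor <;> nlinarith
    · have : (a • p + b • squareCenter w).2 - w.2 = a * (p.2 - w.2) := by
        simp [squareCenter, hb']; ring
      rw [this, abs_lt]
      constructor <;> nlinarith

lemma connectedComponentIn_squareCenter_eq {E : Set (Sym2 GridV)}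
    (hE : ∀ e ∈ E, ∃ v, e = hEdge v ∨ e = vEdge v) {a b : GridV} {e : Sym2 GridV}
    (ha : e ∈ squareEdges a) (hb : e ∈ squareEdges b) (he : e ∉ E) :
    connectedComponentIn (carrierOf E)ᶜ (squareCenter a) =
      connectedComponentIn (carrierOf E)ᶜ (squareCenter b) := by
  obtain ⟨m, hm, hu⟩ := exists_mem_edgeSeg_unique (exists_edge_of_mem_squareEdges ha)
  have hmE : m ∉ carrierOf E := by
    rw [mem_carrierOf]
    rintro ⟨e', he', hm'⟩
    exact he (hu e' (hE e' he') hm' ▸ he')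
  rw [← connectedComponentIn_eq (squareCenter_mem_connectedComponentIn hE
      (edgeSeg_subset_squareSet ha hm) hmE),
    ← connectedComponentIn_eq (squareCenter_mem_connectedComponentIn hE
      (edgeSeg_subset_squareSet hb hm) hmE)]

lemma mem_carrierOf_faceBoundary_of_vertical {F : Set GridV} {x y y' : ℤ} {p : ℝ × ℝ}
    (h : p ∈ squareSet (x, y)) (h' : p ∈ squareSet (x, y'))
    (hne : ¬ ((x, y) ∈ F ↔ (x, y') ∈ F)) : p ∈ carrierOf (faceBoundary F) := by
  wlog hlt : y < y' generalizing y y'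
  · refine this h' h (by tauto) ?_
    rcases (not_lt.1 hlt).eq_or_lt with rfl | h
    · exact absurd Iff.rfl hne
    · exact h
  rw [mem_squareSet] at h h'
  dsimp only at h h'
  have h1 : y' = y + 1 := by
    have : (y' : ℝ) < y + 2 := by linarith
    norm_cast at this
    omega
  subst h1
  rw [mem_carrierOf]
  refine ⟨hEdge (x, y + 1), hEdge_mem_faceBoundary.2 ?_, mem_edgeSeg_hEdge.2 ⟨h.1, ?_⟩⟩
  · simp only [Prod.mk_sub_mk, sub_zero, add_sub_cancel_right]
    tauto
  · push_cast at h' ⊢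
    linarith

lemma mem_carrierOf_faceBoundary_of_horizontal {F : Set GridV} {x x' y : ℤ} {p : ℝ × ℝ}
    (h : p ∈ squareSet (x, y)) (h' : p ∈ squareSet (x', y))
    (hne : ¬ ((x, y) ∈ F ↔ (x', y) ∈ F)) : p ∈ carrierOf (faceBoundary F) := by
  wlog hlt : x < x' generalizing x x'
  · refine this h' h (by tauto) ?_
    rcases (not_lt.1 hlt).eq_or_lt with rfl | h
    · exact absurd Iff.rfl hne
    · exact h
  rw [mem_squareSet] at h h'
  dsimp only at h h'
  have h1 : x' = x + 1 := by
    have : (x' : ℝ) < x + 2 := by linarith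
    norm_cast at this
    omega
  subst h1
  rw [mem_carrierOf]
  refine ⟨vEdge (x + 1, y), vEdge_mem_faceBoundary.2 ?_, mem_edgeSeg_vEdge.2 ⟨?_, h.2⟩⟩
  · simp only [Prod.mk_sub_mk, sub_zero, add_sub_cancel_right]
    tauto
  · push_cast at h' ⊢
    linarith

/-- A point of both a square of `F` and a square outside `F` lies on the boundary of `F`. -/
lemma mem_carrierOf_faceBoundary {F : Set GridV} {w w' : GridV} {p : ℝ × ℝ}
    (hw : w ∈ F) (hw' : w' ∉ F) (h : p ∈ squareSet w) (h' : p ∈ squareSet w') :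
    p ∈ carrierOf (faceBoundary F) := by
  obtain ⟨x, y⟩ := w
  obtain ⟨x', y'⟩ := w'
  have hm : p ∈ squareSet (x, y') :=
    mem_squareSet.2 ⟨(mem_squareSet.1 h).1, (mem_squareSet.1 h').2⟩
  by_cases hmF : (x, y') ∈ F
  · exact mem_carrierOf_faceBoundary_of_horizontal hm h' (by tauto)
  · exact mem_carrierOf_faceBoundary_of_vertical h hm (by tauto)

lemma exists_mem_squareSet (p : ℝ × ℝ) : ∃ w, p ∈ squareSet w := by
  refine ⟨(⌊p.1 + 1 / 2⌋, ⌊p.2 + 1 / 2⌋), mem_squareSet.2 ?_⟩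
  have h1 := Int.floor_le (p.1 + 1 / 2)
  have h2 := Int.lt_floor_add_one (p.1 + 1 / 2)
  have h3 := Int.floor_le (p.2 + 1 / 2)
  have h4 := Int.lt_floor_add_one (p.2 + 1 / 2)
  exact ⟨⟨by linarith, by linarith⟩, by linarith, by linarith⟩

lemma finite_setOf_squareCenter_mem {S : Set (ℝ × ℝ)} (hS : Bornology.IsBounded S) :
    {w | squareCenter w ∈ S}.Finite := by
  obtain ⟨R, hR⟩ := hS.subset_closedBall 0
  refine finite_of_bound ⌈R⌉ fun w hw => ?_
  have h := hR hw
  rw [mem_closedBall_zero_iff, Prod.norm_def, max_le_iff] at h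
  simp only [squareCenter, Real.norm_eq_abs] at h
  have hR := Int.le_ceil R
  constructor
  · have := h.1.trans hR
    exact_mod_cast this
  · have := h.2.trans hR
    exact_mod_cast this

lemma locallyFinite_squareSet : LocallyFinite squareSet := by
  intro p
  refine ⟨Metric.ball p 1, Metric.ball_mem_nhds p one_pos, ?_⟩
  refine (finite_setOf_squareCenter_mem (Metric.isBounded_ball (x := p) (r := 2))).subset ?_
  rintro w ⟨q, hq, hqp⟩
  obtain ⟨⟨h1, h2⟩, h3, h4⟩ := mem_squareSet.1 hq
  rw [Metric.mem_ball, Prod.dist_eq, max_lt_iff, Real.dist_eq, Real.dist_eq, abs_lt, abs_lt] at hqp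
  change squareCenter w ∈ Metric.ball p 2
  rw [Metric.mem_ball, Prod.dist_eq, max_lt_iff, Real.dist_eq, Real.dist_eq, abs_lt, abs_lt]
  simp only [squareCenter]
  exact ⟨⟨by linarith, by linarith⟩, by linarith, by linarith⟩

lemma isClosed_iUnion_squareSet (F : Set GridV) : IsClosed (⋃ w : F, squareSet w) :=
  (locallyFinite_squareSet.comp_injective Subtype.val_injective).isClosed_iUnion
    fun _ => isClosed_Icc

/-- The squares of a finite set are contained in the interior of its boundary. -/
lemma inInterior_faceBoundary {F : Set GridV} (hF : F.Finite) {w : GridV} (hw : w ∈ F) :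
    inInterior (faceBoundary F) (squareSet w) := by
  intro p hp
  by_cases hpE : p ∈ carrierOf (faceBoundary F)
  · exact Or.inr hpE
  refine Or.inl ⟨hpE, ?_⟩
  set S := connectedComponentIn (carrierOf (faceBoundary F))ᶜ p with hS
  have hSsub : S ⊆ (carrierOf (faceBoundary F))ᶜ := connectedComponentIn_subset _ _
  have hbdd : Bornology.IsBounded (⋃ w ∈ F, squareSet w) :=
    (Bornology.isBounded_biUnion hF).2 fun _ _ => Metric.isBounded_Icc _ _
  refine hbdd.subset fun q hq => ?_
  by_contra hqF
  obtain ⟨w', hw'⟩ := exists_mem_squareSet q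
  have hw'F : w' ∉ F := fun h => hqF (Set.mem_biUnion h hw')
  obtain ⟨r, hrS, hr1, hr2⟩ := isPreconnected_closed_iff.1
    (isPreconnected_connectedComponentIn : IsPreconnected S) _ _
    (isClosed_iUnion_squareSet F) (isClosed_iUnion_squareSet Fᶜ) (fun r _ => by
      obtain ⟨v, hv⟩ := exists_mem_squareSet r
      by_cases hvF : v ∈ F
      · exact Or.inl (Set.mem_iUnion.2 ⟨⟨v, hvF⟩, hv⟩)
      · exact Or.inr (Set.mem_iUnion.2 ⟨⟨v, hvF⟩, hv⟩))
    ⟨p, mem_connectedComponentIn hpE, Set.mem_iUnion.2 ⟨⟨w, hw⟩, hp⟩⟩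
    ⟨q, hq, Set.mem_iUnion.2 ⟨⟨w', hw'F⟩, hw'⟩⟩
  obtain ⟨⟨a, ha⟩, hra⟩ := Set.mem_iUnion.1 hr1
  obtain ⟨⟨b, hb⟩, hrb⟩ := Set.mem_iUnion.1 hr2
  exact hSsub hrS (mem_carrierOf_faceBoundary ha hb hra hrb)

/-- When the boundary of a finite set of squares is a cycle, the other squares are contained in
the exterior of this cycle. -/
lemma inExterior_faceBoundary {F : Set GridV} (hF : F.Finite) (hcyc : IsCycle (faceBoundary F))
    {w : GridV} (hw : w ∉ F) : inExterior (faceBoundary F) (squareSet w) := by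
  have hgrid : ∀ e ∈ faceBoundary F, ∃ v, e = hEdge v ∨ e = vEdge v :=
    fun e he => exists_edge_of_mem_faceBoundary he
  intro p hp
  by_cases hpE : p ∈ carrierOf (faceBoundary F)
  · exact Or.inr hpE
  refine Or.inl ⟨hpE, fun hbdd => ?_⟩
  rw [connectedComponentIn_eq (squareCenter_mem_connectedComponentIn hgrid hp hpE)] at hbdd
  set A : Set GridV := {v | v ∉ F ∧ connectedComponentIn (carrierOf (faceBoundary F))ᶜ
    (squareCenter v) = connectedComponentIn (carrierOf (faceBoundary F))ᶜ (squareCenter w)}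
    with hA
  have hAfin : A.Finite := by
    refine (finite_setOf_squareCenter_mem hbdd).subset fun v hv => ?_
    have := mem_connectedComponentIn (F := (carrierOf (faceBoundary F))ᶜ)
      (squareCenter_notMem_carrierOf hgrid v)
    rwa [hv.2] at this
  have hsub : faceBoundary A ⊆ faceBoundary F := by
    rintro e ⟨a, b, ha, hb, hea, heb⟩
    by_contra he
    by_cases hbF : b ∈ F
    · exact he ⟨b, a, hbF, ha.1, heb, hea⟩
    · exact hb ⟨hbF, (connectedComponentIn_squareCenter_eq hgrid heb hea he).trans ha.2⟩
  have hwA : w ∈ A := ⟨hw, rfl⟩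
  have heq := faceBoundary_injOn hAfin hF (hcyc.eq_of_subset hsub
    (faceBoundary_nonempty hAfin ⟨w, hwA⟩) (noDeadEnd_faceBoundary A))
  exact hw (heq ▸ hwA)

lemma disjoint_interiorOf_exteriorOf (E : Set (Sym2 GridV)) :
    Disjoint (interiorOf E) (exteriorOf E) :=
  Set.disjoint_left.2 fun _ h h' => h'.2 h.2

/-- A square contained in the interior of the boundary cycle of a set of squares belongs to
this set. -/
lemma mem_of_inInterior_faceBoundary {F : Set GridV} (hF : F.Finite)
    (hcyc : IsCycle (faceBoundary F)) {w : GridV}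
    (h : inInterior (faceBoundary F) (squareSet w)) : w ∈ F := by
  by_contra hw
  have hc := squareCenter_notMem_carrierOf
    (fun e he => exists_edge_of_mem_faceBoundary (F := F) he) w
  exact Set.disjoint_left.1 (disjoint_interiorOf_exteriorOf _)
    ((h (squareCenter_mem w)).resolve_right hc)
    ((inExterior_faceBoundary hF hcyc hw (squareCenter_mem w)).resolve_right hc)

/-- All edges of the squares of `C`. -/
def squaresEdges (C : Set GridV) : Set (Sym2 GridV) := ⋃ z ∈ C, squareEdges z

lemma mem_squaresEdges {C : Set GridV} {e : Sym2 GridV} :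
    e ∈ squaresEdges C ↔ ∃ z ∈ C, e ∈ squareEdges z := by
  simp [squaresEdges]

/-- The squares enclosed by edges of squares of `C`: the set `C` with its holes filled. -/
def filledSquares (C : Set GridV) : Set GridV :=
  {w | ∃ F : Set GridV, F.Finite ∧ w ∈ F ∧ faceBoundary F ⊆ squaresEdges C}

/-- The component of the square `z` in the filled set of `C`, for adjacency across edges. -/
def filledComp (C : Set GridV) (z : GridV) : Set GridV :=
  {w | Relation.ReflTransGen (fun a b => a ∈ filledSquares C ∧ b ∈ filledSquares C ∧
    ∃ e, e ∈ squareEdges a ∧ e ∈ squareEdges b) z w}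

section Filled

variable {C : Set GridV}

lemma subset_filledSquares : C ⊆ filledSquares C := fun w hw =>
  ⟨{w}, Set.finite_singleton w, rfl, fun _ he => by
    obtain ⟨a, b, rfl, -, hea, -⟩ := he
    exact mem_squaresEdges.2 ⟨_, hw, hea⟩⟩

/-- A square outside `C` with an edge not belonging to squares of `C` is filled together with
its neighbour across this edge. -/
lemma mem_filledSquares_of_adj {a b : GridV} {e : Sym2 GridV} (hea : e ∈ squareEdges a)
    (heb : e ∈ squareEdges b) (he : e ∉ squaresEdges C) (hb : b ∈ filledSquares C) :
    a ∈ filledSquares C := by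
  obtain ⟨F, hF, hbF, hFC⟩ := hb
  refine ⟨F, hF, ?_, hFC⟩
  by_contra haF
  exact he (hFC ⟨b, a, hbF, haF, heb, hea⟩)

/-- An edge between a filled square and a square which is not filled belongs to a square of `C`,
namely the filled one. -/
lemma mem_of_mem_filledSquares_of_notMem {a b : GridV} {e : Sym2 GridV}
    (hea : e ∈ squareEdges a) (heb : e ∈ squareEdges b) (ha : a ∈ filledSquares C)
    (hb : b ∉ filledSquares C) : a ∈ C := by
  by_contra haC
  refine hb (mem_filledSquares_of_adj heb hea (fun he => ?_) ha)
  obtain ⟨z, hz, hez⟩ := mem_squaresEdges.1 he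
  rcases squareEdges_eq_or_eq hea heb hez (fun h => hb (h ▸ ha)) with rfl | rfl
  · exact haC hz
  · exact hb (subset_filledSquares hz)

lemma finite_filledSquares (hC : C.Finite) : (filledSquares C).Finite := by
  obtain ⟨N, hN⟩ := exists_bound_of_finite hC
  refine finite_of_bound N fun w hw => ?_
  obtain ⟨F, hF, hwF, hFC⟩ := hw
  obtain ⟨x, y⟩ := w
  obtain ⟨k, hk1, hk2⟩ := exists_exit hF hwF (d := (1, 0)) (by simp)
  obtain ⟨l, hl1, hl2⟩ := exists_exit hF hwF (d := (-1, 0)) (by simp)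
  have e1 : vEdge ((x, y) + k • (1, 0) + (1, 0)) ∈ faceBoundary F := by
    rw [vEdge_mem_faceBoundary, add_sub_cancel_right]
    tauto
  have e2 : vEdge ((x, y) + l • (-1, 0)) ∈ faceBoundary F := by
    rw [vEdge_mem_faceBoundary, sub_eq_add_neg]
    simp only [Prod.neg_mk, neg_zero]
    tauto
  obtain ⟨z, hz, hez⟩ := mem_squaresEdges.1 (hFC e1)
  obtain ⟨z', hz', hez'⟩ := mem_squaresEdges.1 (hFC e2)
  have hb := hN z hz
  have hb' := hN z' hz'
  simp only [abs_lt] at hb hb'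
  rw [vEdge_mem_squareEdges] at hez hez'
  simp only [abs_le]
  rcases hez with rfl | rfl <;> rcases hez' with rfl | rfl <;> simp at hb hb' ⊢ <;> omega

lemma filledComp_subset {z : GridV} (hz : z ∈ filledSquares C) :
    filledComp C z ⊆ filledSquares C := fun w hw => by
  rcases Relation.ReflTransGen.cases_tail hw with rfl | ⟨_, -, h⟩
  · exact hz
  · exact h.2.1

lemma mem_filledComp_self (z : GridV) : z ∈ filledComp C z := Relation.ReflTransGen.refl

lemma mem_filledComp_of_adj {z a b : GridV} {e : Sym2 GridV} (hz : z ∈ filledSquares C)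
    (ha : a ∈ filledComp C z) (hb : b ∈ filledSquares C) (hea : e ∈ squareEdges a)
    (heb : e ∈ squareEdges b) : b ∈ filledComp C z :=
  Relation.ReflTransGen.tail ha ⟨filledComp_subset hz ha, hb, e, hea, heb⟩

lemma filledComp_eq {z w : GridV} (hw : w ∈ filledComp C z) :
    filledComp C w = filledComp C z := by
  have : Std.Symm (fun a b => a ∈ filledSquares C ∧ b ∈ filledSquares C ∧
      ∃ e, e ∈ squareEdges a ∧ e ∈ squareEdges b) :=
    ⟨fun _ _ ⟨h1, h2, e, h3, h4⟩ => ⟨h2, h1, e, h4, h3⟩⟩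
  exact Set.Subset.antisymm (fun v hv => Relation.ReflTransGen.trans hw hv)
    (fun v hv => Relation.ReflTransGen.trans (Relation.ReflTransGen.stdSymm.symm _ _ hw) hv)

/-- A finite nonempty subset of a component of the filled set whose boundary is contained in the
boundary of the component is the whole component. -/
lemma filledComp_subset_of_faceBoundary_subset {z w : GridV} {F : Set GridV}
    (hz : z ∈ filledSquares C) (hwF : w ∈ F) (hw : w ∈ filledComp C z)
    (hF : faceBoundary F ⊆ faceBoundary (filledComp C z)) : filledComp C z ⊆ F := by
  rw [← filledComp_eq hw]
  intro v hv
  have key : v ∈ F ∧ v ∈ filledComp C z := by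
    induction hv with
    | refl => exact ⟨hwF, hw⟩
    | @tail a b _ h ih =>
      obtain ⟨-, hb, e, hea, heb⟩ := h
      have hbz := mem_filledComp_of_adj hz ih.2 hb hea heb
      refine ⟨?_, hbz⟩
      by_contra hbF
      have hne : a ≠ b := fun h => hbF (h ▸ ih.1)
      rcases mem_or_mem_of_mem_faceBoundary (hF ⟨_, _, ih.1, hbF, hea, heb⟩) hea heb hne with
        h | h
      · exact h.2 hbz
      · exact h.2 ih.2
  exact key.1

lemma exists_of_mem_faceBoundary_filledComp {z : GridV} {e : Sym2 GridV}
    (hz : z ∈ filledSquares C) (he : e ∈ faceBoundary (filledComp C z)) :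
    ∃ a b, a ∈ filledComp C z ∧ a ∈ C ∧ b ∉ filledSquares C ∧ e ∈ squareEdges a ∧
      e ∈ squareEdges b := by
  obtain ⟨a, b, ha, hb, hea, heb⟩ := he
  have hbV : b ∉ filledSquares C := fun h => hb (mem_filledComp_of_adj hz ha h hea heb)
  exact ⟨a, b, ha, mem_of_mem_filledSquares_of_notMem hea heb (filledComp_subset hz ha) hbV,
    hbV, hea, heb⟩

lemma faceBoundary_filledComp_subset {z : GridV} (hz : z ∈ filledSquares C) :
    faceBoundary (filledComp C z) ⊆ squaresEdges C := fun e he => by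
  obtain ⟨a, b, -, ha, -, hea, -⟩ := exists_of_mem_faceBoundary_filledComp hz he
  exact mem_squaresEdges.2 ⟨a, ha, hea⟩

lemma finite_filledComp (hC : C.Finite) {z : GridV} (hz : z ∈ filledSquares C) :
    (filledComp C z).Finite :=
  (finite_filledSquares hC).subset (filledComp_subset hz)

/-- The boundary of a component of the filled set is a cycle. -/
lemma isCycle_faceBoundary_filledComp (hC : C.Finite) {z : GridV} (hz : z ∈ filledSquares C) :
    IsCycle (faceBoundary (filledComp C z)) := by
  have hVfin := finite_filledComp hC hz
  have hDC := faceBoundary_filledComp_subset hz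
  have hCfin : (squaresEdges C).Finite := by
    refine hC.biUnion fun z _ => ?_
    simp only [squareEdges]
    exact Set.toFinite _
  obtain ⟨Z, hZ, hZD⟩ := exists_isCycle_subset (hCfin.subset hDC)
    (faceBoundary_nonempty hVfin ⟨z, mem_filledComp_self z⟩) (noDeadEnd_faceBoundary _)
    (fun a b h => by
      obtain ⟨c, d, -, -, h, -⟩ := h
      exact gridAdj_of_mem_squareEdges h)
  obtain ⟨F, hF, rfl⟩ := hZ.exists_faceBoundary
  have hFV : F ⊆ filledSquares C := fun w hw => ⟨F, hF, hw, hZD.trans hDC⟩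
  have hside : ∀ a b e, a ∈ F → e ∈ squareEdges a → e ∈ squareEdges b → b ∉ F →
      a ∈ filledComp C z := by
    intro a b e ha hea heb hb
    obtain ⟨c, d, hc, -, hd, hec, hed⟩ :=
      exists_of_mem_faceBoundary_filledComp hz (hZD ⟨a, b, ha, hb, hea, heb⟩)
    have hcd : c ≠ d := fun h => hd (h ▸ filledComp_subset hz hc)
    rcases squareEdges_eq_or_eq hec hed hea hcd with rfl | rfl
    · exact hc
    · exact absurd (hFV ha) hd
  have hFsub : F ⊆ filledComp C z := by
    by_contra hnot
    obtain ⟨w, hwF, hwz⟩ := Set.not_subset.1 hnot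
    obtain ⟨e, a, b, ha, hb, hea, heb⟩ :=
      faceBoundary_nonempty (hF.subset (Set.sdiff_subset (t := filledComp C z))) ⟨w, hwF, hwz⟩
    by_cases hbF : b ∈ F
    · have hbz : b ∈ filledComp C z := by
        by_contra h
        exact hb ⟨hbF, h⟩
      exact ha.2 (mem_filledComp_of_adj hz hbz (hFV ha.1) heb hea)
    · exact ha.2 (hside a b e ha.1 hea heb hbF)
  obtain ⟨e, a, b, ha, -⟩ := hZ.nonempty
  rw [← hFsub.antisymm (filledComp_subset_of_faceBoundary_subset hz ha (hFsub ha) hZD)]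
  exact hZ

/-- If the boundary of a set of squares containing `z` is a cycle formed by edges of squares
of `C`, then the set is contained in the component of `z` in the filled set. -/
lemma subset_filledComp {z : GridV} (hz : z ∈ filledSquares C) {F : Set GridV}
    (hF : F.Finite) (hcyc : IsCycle (faceBoundary F)) (hFC : faceBoundary F ⊆ squaresEdges C)
    (hzF : z ∈ F) : F ⊆ filledComp C z := by
  have hFV : F ⊆ filledSquares C := fun w hw => ⟨F, hF, hw, hFC⟩
  have hAfin : (F ∩ filledComp C z).Finite := hF.subset Set.inter_subset_left
  have hsub : faceBoundary (F ∩ filledComp C z) ⊆ faceBoundary F := by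
    rintro e ⟨a, b, ha, hb, hea, heb⟩
    refine ⟨a, b, ha.1, fun hbF => hb ⟨hbF, ?_⟩, hea, heb⟩
    exact mem_filledComp_of_adj hz ha.2 (hFV hbF) hea heb
  have := faceBoundary_injOn hAfin hF (hcyc.eq_of_subset hsub
    (faceBoundary_nonempty hAfin ⟨z, hzF, mem_filledComp_self z⟩) (noDeadEnd_faceBoundary _))
  rw [← this]
  exact Set.inter_subset_right

/-- Two squares of `C` sharing a corner either lie in the same component of the filled set, or
the boundaries of their components share a vertex. -/
lemma filledComp_eq_or_exists_common_vertex {z w : GridV} (hz : z ∈ C) (hw : w ∈ C)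
    (hzw : starAdj z w) :
    filledComp C w = filledComp C z ∨ ∃ v, v ∈ vertexSetOf (faceBoundary (filledComp C z)) ∧
      v ∈ vertexSetOf (faceBoundary (filledComp C w)) := by
  have hzV := subset_filledSquares hz
  have hwV := subset_filledSquares hw
  by_cases hmem : w ∈ filledComp C z
  · exact Or.inl (filledComp_eq hmem)
  right
  have hadj : ∀ a e, e ∈ squareEdges z → e ∈ squareEdges a → a ∈ filledSquares C →
      a ∈ filledComp C z := fun a e h1 h2 h3 =>
    mem_filledComp_of_adj hzV (mem_filledComp_self z) h3 h1 h2
  have key : ∀ a e e' v, e ∈ squareEdges z → e ∈ squareEdges a → e' ∈ squareEdges a →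
      e' ∈ squareEdges w → v ∈ e → v ∈ e' →
      v ∈ vertexSetOf (faceBoundary (filledComp C z)) ∧
      v ∈ vertexSetOf (faceBoundary (filledComp C w)) := by
    intro a e e' v h1 h2 h3 h4 hv hv'
    have haV : a ∉ filledSquares C := fun haV =>
      hmem (mem_filledComp_of_adj hzV (hadj a e h1 h2 haV) hwV h3 h4)
    exact ⟨⟨e, ⟨z, a, mem_filledComp_self z, fun h => haV (filledComp_subset hzV h), h1, h2⟩, hv⟩,
      ⟨e', ⟨w, a, mem_filledComp_self w, fun h => haV (filledComp_subset hwV h), h4, h3⟩, hv'⟩⟩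
  obtain ⟨x, y⟩ := z
  obtain ⟨x', y'⟩ := w
  obtain ⟨hne, h1, h2⟩ := hzw
  simp only [abs_le] at h1 h2
  have hx : x' = x - 1 ∨ x' = x ∨ x' = x + 1 := by omega
  have hy : y' = y - 1 ∨ y' = y ∨ y' = y + 1 := by omega
  rcases hx with rfl | rfl | rfl
  · rcases hy with rfl | rfl | rfl
    · refine ⟨(x, y), key (x, y - 1) (hEdge (x, y)) (vEdge (x, y - 1)) _ ?_ ?_ ?_ ?_ ?_ ?_⟩ <;>
        first | simp [hEdge_mem_squareEdges, vEdge_mem_squareEdges] | simp [hEdge, vEdge]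
    · refine absurd (hadj _ (vEdge (x, y')) ?_ ?_ hwV) hmem <;> simp [vEdge_mem_squareEdges]
    · refine ⟨(x, y + 1),
        key (x, y + 1) (hEdge (x, y + 1)) (vEdge (x, y + 1)) _ ?_ ?_ ?_ ?_ ?_ ?_⟩ <;>
        first | simp [hEdge_mem_squareEdges, vEdge_mem_squareEdges] | simp [hEdge, vEdge]
  · rcases hy with rfl | rfl | rfl
    · refine absurd (hadj _ (hEdge (x', y)) ?_ ?_ hwV) hmem <;> simp [hEdge_mem_squareEdges]
    · exact absurd rfl hne
    · refine absurd (hadj _ (hEdge (x', y + 1)) ?_ ?_ hwV) hmem <;> simp [hEdge_mem_squareEdges]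
  · rcases hy with rfl | rfl | rfl
    · refine ⟨(x + 1, y),
        key (x, y - 1) (hEdge (x, y)) (vEdge (x + 1, y - 1)) _ ?_ ?_ ?_ ?_ ?_ ?_⟩ <;>
        first | simp [hEdge_mem_squareEdges, vEdge_mem_squareEdges] | simp [hEdge, vEdge]
    · refine absurd (hadj _ (vEdge (x + 1, y')) ?_ ?_ hwV) hmem <;> simp [vEdge_mem_squareEdges]
    · refine ⟨(x + 1, y + 1),
        key (x, y + 1) (hEdge (x, y + 1)) (vEdge (x + 1, y + 1)) _ ?_ ?_ ?_ ?_ ?_ ?_⟩ <;>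
        first | simp [hEdge_mem_squareEdges, vEdge_mem_squareEdges] | simp [hEdge, vEdge]

end Filled

lemma starAdj_of_mem_squareEdges {e : Sym2 GridV} {a b : GridV} (ha : e ∈ squareEdges a)
    (hb : e ∈ squareEdges b) (hab : a ≠ b) : starAdj a b := by
  refine ⟨hab, ?_⟩
  obtain ⟨v, rfl | rfl⟩ := exists_edge_of_mem_squareEdges ha
  · rcases hEdge_mem_squareEdges.1 ha with rfl | rfl <;>
      rcases hEdge_mem_squareEdges.1 hb with rfl | rfl <;> simp
  · rcases vEdge_mem_squareEdges.1 ha with rfl | rfl <;>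
      rcases vEdge_mem_squareEdges.1 hb with rfl | rfl <;> simp

section Main

variable {ω : GridV → Prop} {z : GridV}

/-- The boundary of the component of `z` in the filled set is an outermost cycle of `z`. -/
lemma isOutermostCycleOf_faceBoundary_filledComp (hfin : (starComp ω).Finite)
    (hz : z ∈ starComp ω) :
    isOutermostCycleOf ω z (faceBoundary (filledComp (starComp ω) z)) := by
  have hzV := subset_filledSquares hz
  have hVfin := finite_filledComp hfin hzV
  have hcyc := isCycle_faceBoundary_filledComp hfin hzV
  refine ⟨⟨hcyc, faceBoundary_filledComp_subset hzV⟩,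
    inInterior_faceBoundary hVfin (mem_filledComp_self z), fun e he => ?_, ?_⟩
  · obtain ⟨a, b, haz, ha, hb, hea, heb⟩ := exists_of_mem_faceBoundary_filledComp hzV he
    refine ⟨⟨a, ha, hea, inInterior_faceBoundary hVfin haz⟩, b, fun hωb => ?_, heb,
      inExterior_faceBoundary hVfin hcyc fun h => hb (filledComp_subset hzV h)⟩
    have hab : a ≠ b := fun h => hb (h ▸ subset_filledSquares ha)
    exact hb (subset_filledSquares ⟨hωb,
      ha.2.tail ⟨ha.1, hωb, starAdj_of_mem_squareEdges hea heb hab⟩⟩)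
  · rintro E ⟨hE, hEC⟩ hzE e he
    obtain ⟨F, hF, rfl⟩ := hE.exists_faceBoundary
    have hsub := subset_filledComp hzV hF hE hEC (mem_of_inInterior_faceBoundary hF hE hzE)
    obtain ⟨a, -, ha, -, hea, -⟩ := he
    exact Or.inr ((edgeSeg_subset_squareSet hea).trans (inInterior_faceBoundary hVfin (hsub ha)))

/-- The outermost cycle of `z` is unique. -/
lemma isOutermostCycleOf.eq_faceBoundary (hfin : (starComp ω).Finite) (hz : z ∈ starComp ω)
    {D : Set (Sym2 GridV)} (hD : isOutermostCycleOf ω z D) :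
    D = faceBoundary (filledComp (starComp ω) z) := by
  have hzV := subset_filledSquares hz
  have hD₀ := isOutermostCycleOf_faceBoundary_filledComp hfin hz
  obtain ⟨⟨hcyc, hDC⟩, hzD, -, hmax⟩ := hD
  obtain ⟨F, hF, rfl⟩ := hcyc.exists_faceBoundary
  refine (hcyc.eq_of_subset (fun e he => ?_) hD₀.1.1.nonempty (noDeadEnd_faceBoundary _)).symm
  by_contra heD
  have hinner := (hmax _ hD₀.1 hD₀.2.1 e he).resolve_left heD
  obtain ⟨a, b, -, -, hb, hea, heb⟩ := exists_of_mem_faceBoundary_filledComp hzV he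
  have hbF : b ∉ F := fun h => hb ⟨F, hF, h, hDC⟩
  obtain ⟨m, hm, hu⟩ := exists_mem_edgeSeg_unique (exists_edge_of_mem_squareEdges hea)
  have hmE : m ∉ carrierOf (faceBoundary F) := by
    rw [mem_carrierOf]
    rintro ⟨e', he', hm'⟩
    exact heD (hu e' (exists_edge_of_mem_faceBoundary he') hm' ▸ he')
  exact Set.disjoint_left.1 (disjoint_interiorOf_exteriorOf _) ((hinner hm).resolve_right hmE)
    ((inExterior_faceBoundary hF hcyc hbF (edgeSeg_subset_squareSet heb hm)).resolve_right hmE)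

end Main

/-- If `C(0)` is finite and nonempty, the union of the outermost
boundary cycles `D_k` of the squares of `C(0)` is a connected subgraph of `G_C`: any two
vertices on outermost boundary cycles are joined by a path using only edges of outermost
boundary cycles. -/
theorem outermost_cycles_union_connected (ω : GridV → Prop)
    (hfin : (starComp ω).Finite) (hne : (starComp ω).Nonempty) :
    EdgeSetConnected (⋃₀ {D | ∃ z ∈ starComp ω, isOutermostCycleOf ω z D}) := by
  set U := ⋃₀ {D | ∃ z ∈ starComp ω, isOutermostCycleOf ω z D} with hU
  have hvert : ∀ u ∈ vertexSetOf U, ∃ z ∈ starComp ω,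
      u ∈ vertexSetOf (faceBoundary (filledComp (starComp ω) z)) := by
    rintro u ⟨e, ⟨D, ⟨z, hz, hD⟩, heD⟩, hu⟩
    rw [hD.eq_faceBoundary hfin hz] at heD
    exact ⟨z, hz, e, heD, hu⟩
  have hcycle : ∀ z ∈ starComp ω, ∀ u v,
      u ∈ vertexSetOf (faceBoundary (filledComp (starComp ω) z)) →
      v ∈ vertexSetOf (faceBoundary (filledComp (starComp ω) z)) →
      Relation.ReflTransGen (fun a b => s(a, b) ∈ U) u v := by
    intro z hz u v hu hv
    have hD := isOutermostCycleOf_faceBoundary_filledComp hfin hz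
    exact Relation.ReflTransGen.mono (fun a b hab => ⟨_, ⟨z, hz, hD⟩, hab⟩) _ _
      (hD.1.1.connected hu hv)
  obtain ⟨z₀, hz₀⟩ := hne
  have h₀ : (0, 0) ∈ starComp ω := by
    refine ⟨?_, .refl⟩
    rcases Relation.ReflTransGen.cases_head hz₀.2 with h | ⟨_, h, -⟩
    · exact h ▸ hz₀.1
    · exact h.1
  have hbase : ∀ z ∈ starComp ω, ∀ u v,
      u ∈ vertexSetOf (faceBoundary (filledComp (starComp ω) (0, 0))) →
      v ∈ vertexSetOf (faceBoundary (filledComp (starComp ω) z)) →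
      Relation.ReflTransGen (fun a b => s(a, b) ∈ U) u v := by
    rintro z ⟨-, hz⟩ u v hu hv
    induction hz generalizing v with
    | refl => exact hcycle _ h₀ u v hu hv
    | tail hab hbc ih =>
      have hb : _ ∈ starComp ω := ⟨hbc.1, hab⟩
      have hc : _ ∈ starComp ω := ⟨hbc.2.1, hab.tail hbc⟩
      rcases filledComp_eq_or_exists_common_vertex hb hc hbc.2.2 with h | ⟨x, hx, hx'⟩
      · exact ih v (h ▸ hv)
      · exact (ih x hx).trans (hcycle _ hc x v hx' hv)
  have : Std.Symm (fun a b : GridV => s(a, b) ∈ U) :=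
    ⟨fun a b h => by rwa [Sym2.eq_swap]⟩
  intro u v hu hv
  obtain ⟨z, hz, hu⟩ := hvert u hu
  obtain ⟨z', hz', hv⟩ := hvert v hv
  obtain ⟨e, he⟩ := (isOutermostCycleOf_faceBoundary_filledComp hfin h₀).1.1.nonempty
  have hx : e.out.1 ∈ vertexSetOf (faceBoundary (filledComp (starComp ω) (0, 0))) :=
    ⟨e, he, Sym2.out_fst_mem e⟩
  have huv : Relation.ReflTransGen (fun a b => s(a, b) ∈ U) u v :=
    (Relation.ReflTransGen.stdSymm.symm _ _ (hbase z hz _ u hx hu)).trans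
      (hbase z' hz' _ v hx hv)
  obtain ⟨l, hl, hlast⟩ := List.exists_isChain_cons_of_relationReflTransGen huv
  exact ⟨u :: l, rfl, by rw [List.getLast?_eq_some_getLast (List.cons_ne_nil u l), hlast], hl⟩
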